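/- Let g : [0,1] → [0,∞) be a function and let Z be a random vector in R^d such that for every unit vector u ∈ R^d and every ξ ∈ [0,1], P(|u^T Z| > g(ξ)) ≤ ξ. Then for every ξ ∈ [0,1], P(‖Z‖ > (4/3) g(ξ/9^d)) ≤ ξ. -/

import Mathlib

open MeasureTheory
open scoped RealInnerProductSpace

open Metric Module in
/-- Volume bound: an `ε`-separated finite subset of the unit ball of a `d`-dimensional real normed
space has at most `(1 + 2 / ε) ^ d` elements. -/
theorem Finset.card_le_of_separated_of_norm_le_one {E : Type*} [NormedAddCommGroup E]
    [NormedSpace ℝ E] [FiniteDimensional ℝ E] {ε : ℝ} (hε : 0 < ε) (s : Finset E)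
    (hs : ∀ c ∈ s, ‖c‖ ≤ 1) (hsep : (s : Set E).Pairwise fun x y => ε ≤ dist x y) :
    (s.card : ℝ) ≤ (1 + 2 / ε) ^ finrank ℝ E := by
  borelize E
  let ν : Measure E := Measure.addHaar
  have hδ : 0 < ε / 2 := half_pos hε
  have hρ : 0 < 1 + ε / 2 := by positivity
  have hdisj : (s : Set E).PairwiseDisjoint fun c => ball c (ε / 2) := fun x hx y hy hxy =>
    ball_disjoint_ball (by simpa using hsep hx hy hxy)
  have hsub : (⋃ c ∈ s, ball c (ε / 2)) ⊆ ball (0 : E) (1 + ε / 2) :=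
    Set.iUnion₂_subset fun x hx => ball_subset_ball' (by
      rw [dist_zero_right]
      linarith [hs x hx])
  have hvol : (s.card : ENNReal) * ENNReal.ofReal ((ε / 2) ^ finrank ℝ E) * ν (ball 0 1) ≤
      ENNReal.ofReal ((1 + ε / 2) ^ finrank ℝ E) * ν (ball 0 1) := by
    rw [← ν.addHaar_ball_of_pos (0 : E) hρ]
    refine le_trans (le_of_eq ?_) (measure_mono hsub)
    rw [measure_biUnion_finset hdisj fun c _ => measurableSet_ball]
    simp only [ν.addHaar_ball_of_pos _ hδ, Finset.sum_const, nsmul_eq_mul, mul_assoc]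
  have hcard := ENNReal.toReal_le_of_le_ofReal (pow_nonneg hρ.le _)
    ((ENNReal.mul_le_mul_iff_left (measure_ball_pos ν _ zero_lt_one).ne'
      measure_ball_lt_top.ne).1 hvol)
  rw [ENNReal.toReal_mul, ENNReal.toReal_natCast, ENNReal.toReal_ofReal (by positivity),
    ← le_div_iff₀ (by positivity), ← div_pow] at hcard
  refine hcard.trans_eq ?_
  congr 1
  field_simp
  ring

open Metric Module in
/-- The unit sphere of a `d`-dimensional real normed space has a `1 / 4`-net with at most `9 ^ d`
elements. -/
theorem exists_finset_quarter_net_sphere (E : Type*) [NormedAddCommGroup E]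
    [NormedSpace ℝ E] [FiniteDimensional ℝ E] :
    ∃ N : Finset E, N.card ≤ 9 ^ finrank ℝ E ∧ (∀ c ∈ N, ‖c‖ = 1) ∧
      ∀ u : E, ‖u‖ = 1 → ∃ c ∈ N, ‖u - c‖ ≤ 1 / 4 := by
  have hfin (s : Finset E) (hs : (s : Set E) ⊆ sphere 0 1)
      (hsep : IsSeparated ((1 / 4 : NNReal) : ENNReal) (s : Set E)) :
      s.card ≤ 9 ^ finrank ℝ E := by
    have := s.card_le_of_separated_of_norm_le_one (ε := 1 / 4) (by norm_num)
      (fun c hc => (mem_sphere_zero_iff_norm.1 (hs hc)).le) fun x hx y hy hxy => by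
        have h := (hsep hx hy hxy).le
        rw [edist_nndist, ENNReal.coe_le_coe, ← NNReal.coe_le_coe] at h
        simpa using h
    norm_num at this
    exact_mod_cast this
  have hpack : packingNumber (1 / 4) (sphere (0 : E) 1) ≤ (9 ^ finrank ℝ E : ℕ) := by
    refine iSup₂_le fun C hC => iSup_le fun hsep => ?_
    by_contra! hlt
    obtain ⟨t, htC, ht⟩ := Set.exists_subset_encard_eq (Order.add_one_le_of_lt hlt)
    have htfin : t.Finite := Set.finite_of_encard_eq_coe (k := 9 ^ finrank ℝ E + 1) (by
      rw [ht]; norm_cast)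
    lift t to Finset E using htfin
    have hle := hfin t (htC.trans hC) (hsep.subset htC)
    rw [Set.encard_coe_eq_coe_finsetCard] at ht
    norm_cast at ht
    omega
  have htop : packingNumber (1 / 4) (sphere (0 : E) 1) ≠ ⊤ :=
    ne_top_of_le_ne_top (ENat.natCast_ne_top _) hpack
  obtain ⟨C, hCs, hCfin, hCcover, hCcard⟩ := exists_set_encard_eq_coveringNumber
    (ne_top_of_le_ne_top htop (coveringNumber_le_packingNumber _ _))
  lift C to Finset E using hCfin
  refine ⟨C, ?_, fun c hc => mem_sphere_zero_iff_norm.1 (hCs hc), fun u hu => ?_⟩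
  · rw [Set.encard_coe_eq_coe_finsetCard] at hCcard
    exact_mod_cast hCcard.trans_le ((coveringNumber_le_packingNumber _ _).trans hpack)
  · obtain ⟨c, hc, huc⟩ := hCcover (mem_sphere_zero_iff_norm.2 hu)
    refine ⟨c, hc, ?_⟩
    change edist u c ≤ _ at huc
    rw [edist_nndist, ENNReal.coe_le_coe, ← NNReal.coe_le_coe, coe_nndist, dist_eq_norm] at huc
    simpa using huc

/-- If the direction of `z` is within `1 / 4` of `c`, then `⟪c, z⟫` is at least `3 / 4 * ‖z‖`. -/
theorem three_quarters_mul_norm_le_inner {E : Type*} [NormedAddCommGroup E]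
    [InnerProductSpace ℝ E] {c z : E} (hc : ‖‖z‖⁻¹ • z - c‖ ≤ 1 / 4) :
    3 / 4 * ‖z‖ ≤ ⟪c, z⟫ := by
  have hz : ⟪‖z‖⁻¹ • z, z⟫ = ‖z‖ := by
    rw [real_inner_smul_left, real_inner_self_eq_norm_sq]
    rcases eq_or_ne ‖z‖ 0 with h | h
    · simp [h]
    · field_simp
  have h := real_inner_le_norm (‖z‖⁻¹ • z - c) z
  rw [inner_sub_left, hz] at h
  linarith [mul_le_mul_of_nonneg_right hc (norm_nonneg z)]

/-- ε-net lifting of one-dimensional tail bounds to the Euclidean norm of a random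
vector: if `P(|uᵀZ| > g(ξ)) ≤ ξ` for every unit vector `u` and every `ξ ∈ [0,1]`,
then `P(‖Z‖ > (4/3) g(ξ/9^d)) ≤ ξ`. -/
theorem stmt_1 {Ω : Type*} [MeasurableSpace Ω] (μ : Measure Ω) [IsProbabilityMeasure μ]
    {d : ℕ} (g : ℝ → ℝ) (hg : ∀ ξ ∈ Set.Icc (0 : ℝ) 1, 0 ≤ g ξ)
    (Z : Ω → EuclideanSpace ℝ (Fin d)) (hZ : Measurable Z)
    (h : ∀ u : EuclideanSpace ℝ (Fin d), ‖u‖ = 1 → ∀ ξ ∈ Set.Icc (0 : ℝ) 1,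
      μ {ω | g ξ < |⟪u, Z ω⟫|} ≤ ENNReal.ofReal ξ) :
    ∀ ξ ∈ Set.Icc (0 : ℝ) 1,
      μ {ω | (4 / 3 : ℝ) * g (ξ / 9 ^ d) < ‖Z ω‖} ≤ ENNReal.ofReal ξ := by
  intro ξ hξ
  obtain ⟨N, hNcard, hNnorm, hNnet⟩ := exists_finset_quarter_net_sphere (EuclideanSpace ℝ (Fin d))
  rw [finrank_euclideanSpace_fin] at hNcard
  have hη : ξ / 9 ^ d ∈ Set.Icc (0 : ℝ) 1 :=
    ⟨div_nonneg hξ.1 (by positivity),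
      (div_le_self hξ.1 (one_le_pow₀ (by norm_num))).trans hξ.2⟩
  have hsub : {ω | (4 / 3 : ℝ) * g (ξ / 9 ^ d) < ‖Z ω‖} ⊆
      ⋃ c ∈ N, {ω | g (ξ / 9 ^ d) < |⟪c, Z ω⟫|} := by
    intro ω hω
    rw [Set.mem_ofPred_eq] at hω
    have hpos : ‖Z ω‖ ≠ 0 := by linarith [hg _ hη]
    obtain ⟨c, hcN, hc⟩ := hNnet (‖Z ω‖⁻¹ • Z ω) (by
      rw [norm_smul, norm_inv, norm_norm, inv_mul_cancel₀ hpos])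
    refine Set.mem_biUnion hcN ?_
    rw [Set.mem_ofPred_eq]
    refine lt_of_lt_of_le ?_ (le_abs_self _)
    linarith [three_quarters_mul_norm_le_inner hc]
  calc μ {ω | (4 / 3 : ℝ) * g (ξ / 9 ^ d) < ‖Z ω‖}
      ≤ ∑ c ∈ N, μ {ω | g (ξ / 9 ^ d) < |⟪c, Z ω⟫|} :=
        (measure_mono hsub).trans (measure_biUnion_finset_le _ _)
    _ ≤ ∑ _c ∈ N, ENNReal.ofReal (ξ / 9 ^ d) :=
        Finset.sum_le_sum fun c hc => h c (hNnorm c hc) _ hη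
    _ = ENNReal.ofReal (N.card * (ξ / 9 ^ d)) := by
        rw [Finset.sum_const, nsmul_eq_mul, ENNReal.ofReal_mul (Nat.cast_nonneg _),
          ENNReal.ofReal_natCast]
    _ ≤ ENNReal.ofReal ξ := by
        refine ENNReal.ofReal_le_ofReal ?_
        calc (N.card : ℝ) * (ξ / 9 ^ d) ≤ 9 ^ d * (ξ / 9 ^ d) :=
              mul_le_mul_of_nonneg_right (by exact_mod_cast hNcard) hη.1
          _ = ξ := by field_simp
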